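/- Fix c > 1. Then lim_{ν→∞} (π/2)·ν·√(c² − 1)·M²(ν, cν) = 1. -/

import Mathlib

open Real MeasureTheory Set Filter

/-- Integral representation of the modified Bessel function `K₀`. -/
noncomputable def K0 (x : ℝ) : ℝ := ∫ t in Ioi (0:ℝ), Real.exp (-x * Real.cosh t)

/-- Bessel modulus squared, via Nicholson's formula. -/
noncomputable def M2 (ν z : ℝ) : ℝ :=
  (8 / π ^ 2) * ∫ t in Ioi (0:ℝ), K0 (2 * z * Real.sinh t) * Real.cosh (2 * ν * t)

lemma integrableOn_exp_neg_mul_cosh {x : ℝ} (hx : 0 < x) :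
    IntegrableOn (fun t => Real.exp (-x * Real.cosh t)) (Ioi 0) := by
  refine (exp_neg_integrableOn_Ioi 0 hx).mono' (by fun_prop) ?_
  filter_upwards [ae_restrict_mem measurableSet_Ioi] with t ht
  rw [Real.norm_eq_abs, Real.abs_exp, Real.exp_le_exp]
  have h : t ≤ Real.cosh t :=
    (Real.self_le_sinh_iff.2 (le_of_lt ht)).trans (Real.sinh_lt_cosh t).le
  nlinarith

lemma K0_nonneg (x : ℝ) : 0 ≤ K0 x :=
  integral_nonneg fun _ => (Real.exp_pos _).le

lemma K0_le_K0 {x y : ℝ} (hx : 0 < x) (hxy : x ≤ y) : K0 y ≤ K0 x := by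
  refine integral_mono (integrableOn_exp_neg_mul_cosh (hx.trans_le hxy))
    (integrableOn_exp_neg_mul_cosh hx) fun t => ?_
  refine Real.exp_le_exp.2 ?_
  nlinarith [Real.cosh_pos t]

lemma continuousAt_K0 {x : ℝ} (hx : 0 < x) : ContinuousAt K0 x := by
  refine continuousAt_of_dominated (bound := fun t => Real.exp (-(x / 2) * Real.cosh t))
    (.of_forall fun _ => by fun_prop) ?_
    (integrableOn_exp_neg_mul_cosh (half_pos hx)) (.of_forall fun _ => by fun_prop)
  filter_upwards [lt_mem_nhds (half_lt_self hx)] with y hy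
  refine .of_forall fun t => ?_
  rw [Real.norm_eq_abs, Real.abs_exp, Real.exp_le_exp]
  nlinarith [Real.cosh_pos t]

lemma integrableOn_exp_neg_mul_cosh_self {a : ℝ} (ha : 1 < a) :
    IntegrableOn (fun s => Real.exp (-a * s) * Real.cosh s) (Ioi 0) ∧
      ∫ s in Ioi (0 : ℝ), Real.exp (-a * s) * Real.cosh s = a / (a ^ 2 - 1) := by
  have e : (fun s => Real.exp (-a * s) * Real.cosh s) =
      fun s => (Real.exp ((1 - a) * s) + Real.exp ((-1 - a) * s)) / 2 := by
    ext s
    rw [Real.cosh_eq, mul_div_assoc', mul_add, ← Real.exp_add, ← Real.exp_add]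
    ring_nf
  have i₁ := integrableOn_exp_mul_Ioi (show 1 - a < 0 by linarith) 0
  have i₂ := integrableOn_exp_mul_Ioi (show -1 - a < 0 by linarith) 0
  rw [e]
  refine ⟨(i₁.add i₂).div_const 2, ?_⟩
  rw [integral_div, integral_add i₁ i₂, integral_exp_mul_Ioi (by linarith),
    integral_exp_mul_Ioi (by linarith)]
  have h₁ : 1 - a ≠ 0 := by linarith
  have h₂ : -1 - a ≠ 0 := by linarith
  have h₃ : a ^ 2 - 1 ≠ 0 := by nlinarith
  simp only [mul_zero, Real.exp_zero]
  field_simp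
  ring

lemma integrableOn_cosh_div {c : ℝ} (hc : 1 < c) :
    IntegrableOn (fun u => c * Real.cosh u / ((c * Real.cosh u) ^ 2 - 1)) (Ioi 0) ∧
      ∫ u in Ioi (0 : ℝ), c * Real.cosh u / ((c * Real.cosh u) ^ 2 - 1) =
        π / 2 / √(c ^ 2 - 1) := by
  have hc2 : 0 < c ^ 2 - 1 := by nlinarith
  have hr : 0 < √(c ^ 2 - 1) := Real.sqrt_pos.2 hc2
  have hr2 : √(c ^ 2 - 1) ^ 2 = c ^ 2 - 1 := Real.sq_sqrt hc2.le
  set r := √(c ^ 2 - 1)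
  have hpos (u : ℝ) : 0 < (c * Real.cosh u) ^ 2 - 1 := by
    nlinarith [Real.cosh_sq u, sq_nonneg (c * Real.sinh u)]
  have hd (u : ℝ) : HasDerivAt (fun u => Real.arctan (c * Real.sinh u / r) / r)
      (c * Real.cosh u / ((c * Real.cosh u) ^ 2 - 1)) u := by
    refine ((((Real.hasDerivAt_sinh u).const_mul c).div_const r).arctan.div_const r).congr_deriv ?_
    have h : (c * Real.cosh u) ^ 2 - 1 = r ^ 2 + (c * Real.sinh u) ^ 2 := by
      rw [hr2, mul_pow, mul_pow, Real.cosh_sq]; ring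
    have h' : r ^ 2 + (c * Real.sinh u) ^ 2 ≠ 0 := by positivity
    rw [h]
    field_simp
  have hlim : Tendsto (fun u => Real.arctan (c * Real.sinh u / r) / r) atTop
      (nhds (π / 2 / r)) := by
    refine Tendsto.div_const ((tendsto_nhds_of_tendsto_nhdsWithin
      Real.tendsto_arctan_atTop).comp ?_) r
    refine Tendsto.atTop_div_const hr (Tendsto.const_mul_atTop (by linarith) ?_)
    refine tendsto_atTop_mono' _ ?_ tendsto_id
    filter_upwards [eventually_ge_atTop 0] with u hu using Real.self_le_sinh_iff.2 hu
  have hn : ∀ u ∈ Ioi (0 : ℝ), 0 ≤ c * Real.cosh u / ((c * Real.cosh u) ^ 2 - 1) :=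
    fun u _ => div_nonneg (by have := Real.cosh_pos u; positivity) (hpos u).le
  refine ⟨integrableOn_Ioi_deriv_of_nonneg' (fun u _ => hd u) hn hlim, ?_⟩
  rw [integral_Ioi_of_hasDerivAt_of_nonneg' (fun u _ => hd u) hn hlim]
  simp

/-- The Laplace-type integral of `K₀` against `cosh`. -/
lemma integrableOn_K0_mul_cosh {c : ℝ} (hc : 1 < c) :
    IntegrableOn (fun s => K0 (c * s) * Real.cosh s) (Ioi 0) ∧
      ∫ s in Ioi (0 : ℝ), K0 (c * s) * Real.cosh s = π / 2 / √(c ^ 2 - 1) := by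
  have hcu (u : ℝ) : 1 < c * Real.cosh u := by nlinarith [Real.one_le_cosh u]
  have hint : Integrable
      (Function.uncurry fun s u => Real.exp (-(c * Real.cosh u) * s) * Real.cosh s)
      ((volume.restrict (Ioi (0 : ℝ))).prod (volume.restrict (Ioi (0 : ℝ)))) := by
    rw [integrable_prod_iff' (by unfold Function.uncurry; fun_prop)]
    refine ⟨.of_forall fun u => (integrableOn_exp_neg_mul_cosh_self (hcu u)).1, ?_⟩
    refine (integrableOn_cosh_div hc).1.congr (.of_forall fun u => ?_)
    simp only [Function.uncurry, norm_mul, Real.norm_eq_abs, Real.abs_exp,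
      abs_of_pos (Real.cosh_pos _)]
    exact (integrableOn_exp_neg_mul_cosh_self (hcu u)).2.symm
  have hK (s : ℝ) : ∫ u in Ioi (0 : ℝ), Real.exp (-(c * Real.cosh u) * s) * Real.cosh s =
      K0 (c * s) * Real.cosh s := by
    rw [integral_mul_const, K0]
    congr! 4 with u
    ring
  refine ⟨hint.integral_prod_left.congr (.of_forall hK), ?_⟩
  simp_rw [← hK]
  rw [integral_integral_swap hint, ← (integrableOn_cosh_div hc).2]
  exact integral_congr_ae (.of_forall fun u => (integrableOn_exp_neg_mul_cosh_self (hcu u)).2)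

lemma tendsto_mul_sinh_div (c : ℝ) {s : ℝ} (hs : 0 < s) :
    Tendsto (fun ν : ℝ => 2 * (c * ν) * Real.sinh (s / (2 * ν))) atTop (nhds (c * s)) := by
  have h0 : Tendsto (fun ν : ℝ => s / (2 * ν)) atTop (nhdsWithin 0 {0}ᶜ) := by
    refine tendsto_nhdsWithin_iff.2 ⟨tendsto_const_nhds.div_atTop
      (tendsto_id.const_mul_atTop two_pos), ?_⟩
    filter_upwards [eventually_gt_atTop 0] with ν hν
    exact (by positivity : s / (2 * ν) ≠ 0)
  have h := (((Real.hasDerivAt_sinh 0).tendsto_slope_zero.comp h0).const_mul (c * s))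
  rw [Real.cosh_zero, mul_one] at h
  refine h.congr' ?_
  filter_upwards [eventually_gt_atTop 0] with ν hν
  simp only [Function.comp, zero_add, Real.sinh_zero, sub_zero, smul_eq_mul]
  field_simp

lemma tendsto_integral_K0_sinh_mul_cosh {c : ℝ} (hc : 1 < c) :
    Tendsto (fun ν : ℝ => ∫ s in Ioi (0 : ℝ),
      K0 (2 * (c * ν) * Real.sinh (s / (2 * ν))) * Real.cosh s) atTop
      (nhds (π / 2 / √(c ^ 2 - 1))) := by
  rw [← (integrableOn_K0_mul_cosh hc).2]
  have hc0 : 0 < c := by linarith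
  refine tendsto_integral_filter_of_dominated_convergence _ ?_ ?_
    (integrableOn_K0_mul_cosh hc).1 ?_
  · filter_upwards [eventually_gt_atTop 0] with ν hν
    refine ContinuousOn.aestronglyMeasurable (fun s hs => ?_) measurableSet_Ioi
    have hs : 0 < s := hs
    have hpos : 0 < 2 * (c * ν) * Real.sinh (s / (2 * ν)) :=
      mul_pos (by positivity) (Real.sinh_pos_iff.2 (by positivity))
    have hcont : ContinuousAt (fun s => 2 * (c * ν) * Real.sinh (s / (2 * ν))) s := by fun_prop
    exact ((ContinuousAt.comp_of_eq (continuousAt_K0 hpos) hcont rfl).mul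
      Real.continuous_cosh.continuousAt).continuousWithinAt
  · filter_upwards [eventually_gt_atTop 0] with ν hν
    filter_upwards [ae_restrict_mem measurableSet_Ioi] with s hs
    have hs : 0 < s := hs
    rw [norm_mul, Real.norm_of_nonneg (K0_nonneg _), Real.norm_of_nonneg (Real.cosh_pos s).le]
    refine mul_le_mul_of_nonneg_right (K0_le_K0 (by positivity) ?_) (Real.cosh_pos s).le
    calc c * s = 2 * (c * ν) * (s / (2 * ν)) := by field_simp
      _ ≤ _ := mul_le_mul_of_nonneg_left (Real.self_le_sinh_iff.2 (by positivity)) (by positivity)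
  · filter_upwards [ae_restrict_mem measurableSet_Ioi] with s hs
    have hs : 0 < s := hs
    exact ((continuousAt_K0 (by positivity : 0 < c * s)).tendsto.comp
      (tendsto_mul_sinh_div c hs)).mul_const _

lemma M2_eq_rescaled (z : ℝ) {ν : ℝ} (hν : 0 < ν) :
    M2 ν z = 4 / (π ^ 2 * ν) * ∫ s in Ioi (0 : ℝ),
      K0 (2 * z * Real.sinh (s / (2 * ν))) * Real.cosh s := by
  have h := integral_comp_mul_left_Ioi
    (fun s => K0 (2 * z * Real.sinh (s / (2 * ν))) * Real.cosh s) 0 (by positivity : 0 < 2 * ν)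
  have hν' : 2 * ν ≠ 0 := by positivity
  simp only [mul_div_cancel_left₀ _ hν', mul_zero, smul_eq_mul] at h
  rw [M2, h]
  field_simp
  ring

/-- Leading asymptotics of `M²` in the Debye regime `z = cν`, `c > 1`. -/
theorem M2_debye_regime_gt_one (c : ℝ) (hc : 1 < c) :
    Tendsto (fun ν : ℝ => (π / 2) * ν * Real.sqrt (c ^ 2 - 1) * M2 ν (c * ν))
      atTop (nhds 1) := by
  have hr : 0 < √(c ^ 2 - 1) := Real.sqrt_pos.2 (by nlinarith)
  have h := (tendsto_integral_K0_sinh_mul_cosh hc).const_mul (2 * √(c ^ 2 - 1) / π)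
  have h1 : 2 * √(c ^ 2 - 1) / π * (π / 2 / √(c ^ 2 - 1)) = 1 := by field_simp
  rw [h1] at h
  refine h.congr' ?_
  filter_upwards [eventually_gt_atTop 0] with ν hν
  rw [M2_eq_rescaled _ hν]
  field_simp
  ring
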